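/- arXiv:0810.4236 — 2 statements merged into one kernel-verified Lean document; each statement's English description precedes it below -/
import Mathlib

section
/- (Lemma 2.1(3)) For every i with 2 ≤ i ≤ k, one has u_2 + u_3 + ⋯ + u_i = u_{k+2−i} + u_{k+3−i} + ⋯ + u_k. -/
open Finset

/-- The set `F = { l / w j : 0 ≤ l ≤ w j - 1, 0 ≤ j ≤ n }` of rational numbers. -/
def wpF (n : ℕ) (w : Fin (n + 1) → ℕ) : Finset ℚ :=
  (Finset.univ.sigma fun j : Fin (n + 1) => Finset.range (w j)).image
    fun p => (p.2 : ℚ) / (w p.1 : ℚ)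

-- The set `S f = { j ∈ {0,…,n} : w j · f ∈ ℤ }`.
open Classical in
noncomputable def wpS (n : ℕ) (w : Fin (n + 1) → ℕ) (x : ℚ) : Finset (Fin (n + 1)) :=
  Finset.univ.filter fun j => ∃ z : ℤ, (w j : ℚ) * x = (z : ℚ)

theorem wpS_one_sub (n : ℕ) (w : Fin (n + 1) → ℕ) (x : ℚ) : wpS n w (1 - x) = wpS n w x := by
  ext j
  simp only [wpS, mem_filter, mem_univ, true_and]
  constructor
  · rintro ⟨z, hz⟩
    exact ⟨w j - z, by push_cast; linarith⟩
  · rintro ⟨z, hz⟩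
    exact ⟨w j - z, by push_cast; linarith⟩

theorem mem_wpF_iff {n : ℕ} {w : Fin (n + 1) → ℕ} (hw : ∀ j, 0 < w j) {x : ℚ} :
    x ∈ wpF n w ↔ 0 ≤ x ∧ x < 1 ∧ (wpS n w x).Nonempty := by
  simp only [wpF, wpS, mem_image, mem_sigma, mem_univ, true_and, mem_range, Finset.Nonempty,
    mem_filter]
  constructor
  · rintro ⟨⟨j, l⟩, hl, rfl⟩
    have hj : (0 : ℚ) < w j := by exact_mod_cast hw j
    refine ⟨by positivity, ?_, j, l, ?_⟩
    · rw [div_lt_one hj]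
      exact_mod_cast hl
    · push_cast
      field_simp
  · rintro ⟨h0, h1, j, z, hz⟩
    have hj : (0 : ℚ) < w j := by exact_mod_cast hw j
    have hz0 : 0 ≤ z := by
      have : (0 : ℚ) ≤ z := hz ▸ by positivity
      exact_mod_cast this
    lift z to ℕ using hz0
    push_cast at hz
    refine ⟨⟨j, z⟩, ?_, ?_⟩
    · have : (z : ℚ) < w j := by nlinarith
      exact_mod_cast this
    · rw [div_eq_iff hj.ne']
      linarith

theorem one_sub_mem_wpF {n : ℕ} {w : Fin (n + 1) → ℕ} (hw : ∀ j, 0 < w j) {x : ℚ}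
    (hx : x ∈ wpF n w) (hx0 : 0 < x) : 1 - x ∈ wpF n w := by
  rw [mem_wpF_iff hw] at hx ⊢
  rw [wpS_one_sub]
  exact ⟨by linarith, by linarith, hx.2.2⟩

/-- A strictly decreasing self-map of `{1, …, m}` is the order reversal. -/
theorem strictAntiOn_Icc_eq_sub {m : ℕ} {φ : ℕ → ℕ} (hφ : StrictAntiOn φ (Set.Icc 1 m))
    (hmaps : Set.MapsTo φ (Set.Icc 1 m) (Set.Icc 1 m)) {l : ℕ} (hl : l ∈ Set.Icc 1 m) :
    φ l = m + 1 - l := by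
  have hstep (a : ℕ) (h1 : 1 ≤ a) (h2 : a + 1 ≤ m) : φ (a + 1) < φ a :=
    hφ ⟨h1, by omega⟩ ⟨by omega, h2⟩ (by omega)
  have hupper (d : ℕ) (hd : d + 1 ≤ m) : φ (d + 1) + d ≤ m := by
    induction d with
    | zero => exact (hmaps ⟨le_rfl, hd⟩).2
    | succ d ih =>
      have := ih (by omega)
      have := hstep (d + 1) (by omega) hd
      omega
  have hlower (d : ℕ) (hd : d + 1 ≤ m) : d + 1 ≤ φ (m - d) := by
    induction d with
    | zero => exact (hmaps ⟨hd, le_rfl⟩).1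
    | succ d ih =>
      have := ih (by omega)
      have := hstep (m - (d + 1)) (by omega) (by omega)
      rw [show m - (d + 1) + 1 = m - d by omega] at this
      omega
  obtain ⟨h1, h2⟩ := hl
  have hu := hupper (l - 1) (by omega)
  have hl := hlower (m - l) (by omega)
  rw [show l - 1 + 1 = l by omega] at hu
  rw [show m - (m - l) = l by omega] at hl
  omega

theorem lemma_2_1_3 (n k : ℕ) (w : Fin (n + 1) → ℕ) (hw : ∀ j, 0 < w j)
    (f : ℕ → ℚ)
    (hmono : ∀ i j : ℕ, 1 ≤ i → i < j → j ≤ k + 1 → f i < f j)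
    (hmem : ∀ i : ℕ, 1 ≤ i → i ≤ k → f i ∈ wpF n w)
    (hsurj : ∀ x ∈ wpF n w, ∃ i : ℕ, 1 ≤ i ∧ i ≤ k ∧ f i = x)
    (hf1 : f 1 = 0) (hfk1 : f (k + 1) = 1) :
    ∀ i : ℕ, 2 ≤ i → i ≤ k →
      ∑ l ∈ Finset.Icc 2 i, (wpS n w (f l)).card =
        ∑ l ∈ Finset.Icc (k + 2 - i) k, (wpS n w (f l)).card := by
  intro i hi hik
  have hf : StrictMonoOn f (Set.Icc 1 (k + 1)) := fun a ha b hb hab => hmono a b ha.1 hab hb.2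
  have hrefl (l : ℕ) (hl : l ∈ Set.Icc 1 (k + 1)) :
      ∃ m ∈ Set.Icc 1 (k + 1), f m = 1 - f l := by
    obtain ⟨h1, h2⟩ := hl
    rcases h1.eq_or_lt with rfl | h1
    · exact ⟨k + 1, ⟨h2, le_rfl⟩, by rw [hf1, hfk1, sub_zero]⟩
    rcases h2.eq_or_lt with rfl | h2
    · exact ⟨1, ⟨le_rfl, by omega⟩, by rw [hf1, hfk1, sub_self]⟩
    have hpos : 0 < f l := hf1 ▸ hmono 1 l le_rfl h1 h2.le
    obtain ⟨m, hm1, hmk, hm⟩ :=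
      hsurj _ (one_sub_mem_wpF hw (hmem l h1.le (by omega)) hpos)
    exact ⟨m, ⟨hm1, by omega⟩, hm⟩
  choose! φ hφ hfφ using hrefl
  have hanti : StrictAntiOn φ (Set.Icc 1 (k + 1)) := by
    intro a ha b hb hab
    rw [← hf.lt_iff_lt (hφ b hb) (hφ a ha), hfφ a ha, hfφ b hb]
    linarith [hf ha hb hab]
  have hcard (l : ℕ) (hl : l ∈ Set.Icc 1 (k + 1)) :
      (wpS n w (f l)).card = (wpS n w (f (k + 2 - l))).card := by
    rw [← strictAntiOn_Icc_eq_sub hanti hφ hl, hfφ l hl, wpS_one_sub]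
  refine Finset.sum_nbij' (fun l => k + 2 - l) (fun l => k + 2 - l) ?_ ?_ ?_ ?_ ?_
  all_goals
    intro l hl
    rw [mem_Icc] at hl
  · rw [mem_Icc]
    omega
  · rw [mem_Icc]
    omega
  · omega
  · omega
  · exact hcard l ⟨by omega, by omega⟩
end

section
/- The characteristic polynomial of the matrix M is X^σ − q/w^w, i.e. det(X·I − M) = X^σ − q/w^w. -/
open Finset

theorem charpoly_weighted_cycle {R : Type*} [CommRing R] (N : ℕ) (hN : 0 < N) (r : ℕ → R)
    (M : Matrix (Fin N) (Fin N) R)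
    (hM : ∀ β α : Fin N,
      M β α = if (β : ℕ) = ((α : ℕ) + 1) % N then r ((α : ℕ) + 1) else 0) :
    M.charpoly = Polynomial.X ^ N - Polynomial.C (∏ α ∈ Finset.Icc 1 N, r α) := by
  have hIcc : ∀ K, ∏ α ∈ Finset.Icc 1 K, r α = ∏ α ∈ Finset.range K, r (α + 1) := by
    intro K
    rw [← Finset.Ico_add_one_right_eq_Icc, Finset.prod_Ico_eq_prod_range]
    exact Finset.prod_congr rfl fun i _ => by rw [add_comm]
  obtain _ | _ | m := N
  · omega
  · simp [Matrix.charpoly, hM]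
  rw [Matrix.charpoly, Matrix.det_succ_row_zero, Fin.sum_univ_succ, Fin.sum_univ_castSucc]
  have hmid : ∀ i : Fin m, M.charmatrix 0 i.castSucc.succ = 0 := by
    intro i
    have h : (i : ℕ) + 1 + 1 < m + 1 + 1 := by omega
    rw [Matrix.charmatrix_apply_ne _ _ _ (Fin.succ_ne_zero _).symm, hM]
    simp [Nat.mod_eq_of_lt h]
  have hlast : M.charmatrix 0 (Fin.last m).succ = -Polynomial.C (r (m + 1 + 1)) := by
    rw [Matrix.charmatrix_apply_ne _ _ _ (Fin.succ_ne_zero _).symm, hM]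
    simp
  have hzero : M.charmatrix 0 0 = Polynomial.X := by
    rw [Matrix.charmatrix_apply_eq, hM]
    simp
  have hdet0 : (M.charmatrix.submatrix Fin.succ (Fin.succAbove 0)).det =
      Polynomial.X ^ (m + 1) := by
    rw [Matrix.det_of_isLowerTriangular]
    · rw [Finset.prod_congr rfl (g := fun _ => Polynomial.X)]
      · simp
      · intro i _
        simp only [Matrix.submatrix_apply, Fin.succAbove_zero]
        rw [Matrix.charmatrix_apply_eq, hM, if_neg]
        · simp
        · simp only [Fin.val_succ]
          rcases Nat.lt_or_ge (i + 1 + 1) (m + 1 + 1) with h | h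
          · rw [Nat.mod_eq_of_lt h]; omega
          · rw [show (i : ℕ) + 1 + 1 = m + 1 + 1 by omega, Nat.mod_self]; omega
    · intro i j hij
      replace hij : i < j := hij
      simp only [Matrix.submatrix_apply, Fin.succAbove_zero]
      rw [Matrix.charmatrix_apply_ne _ _ _ (by simpa using hij.ne), hM, if_neg]
      · simp
      · simp only [Fin.val_succ]
        rcases Nat.lt_or_ge (j + 1 + 1) (m + 1 + 1) with h | h
        · rw [Nat.mod_eq_of_lt h]; omega
        · rw [show (j : ℕ) + 1 + 1 = m + 1 + 1 by omega, Nat.mod_self]; omega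
  have hdet1 : (M.charmatrix.submatrix Fin.succ (Fin.succAbove (Fin.last m).succ)).det =
      (-1) ^ (m + 1) * Polynomial.C (∏ α ∈ Finset.range (m + 1), r (α + 1)) := by
    rw [Matrix.det_of_isUpperTriangular]
    · rw [Finset.prod_congr rfl (g := fun i : Fin (m + 1) => -Polynomial.C (r (i + 1)))]
      · rw [Finset.prod_neg, ← Fin.prod_univ_eq_prod_range (fun α => r (α + 1))]
        simp
      · intro i _
        simp only [Matrix.submatrix_apply, Fin.succ_last, Fin.succAbove_last]
        rw [Matrix.charmatrix_apply_ne _ _ _ (by simp [Fin.ext_iff]), hM, if_pos]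
        · simp
        · simp only [Fin.val_succ, Fin.val_castSucc]
          rw [Nat.mod_eq_of_lt (by omega)]
    · intro i j hij
      replace hij : j < i := hij
      simp only [Matrix.submatrix_apply, Fin.succ_last, Fin.succAbove_last]
      rw [Matrix.charmatrix_apply_ne _ _ _ (by simp [Fin.ext_iff]; omega), hM, if_neg]
      · simp
      · simp only [Fin.val_succ, Fin.val_castSucc]
        rw [Nat.mod_eq_of_lt (by omega)]; omega
  rw [Finset.sum_eq_zero fun i _ => by rw [hmid]; simp, hzero, hlast, hdet0, hdet1, hIcc,
    Finset.prod_range_succ _ (m + 1), Polynomial.C_mul]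
  have hsign : ((-1 : Polynomial R) ^ (m + 1)) * (-1) ^ (m + 1) = 1 := by
    rw [← mul_pow]; simp
  simp only [Fin.val_zero, pow_zero, one_mul, zero_add, Fin.val_succ, Fin.val_last]
  linear_combination (-Polynomial.C (r (m + 1 + 1)) *
    Polynomial.C (∏ α ∈ Finset.range (m + 1), r (α + 1))) * hsign

theorem mem_wpF {n : ℕ} {w : Fin (n + 1) → ℕ} {x : ℚ} :
    x ∈ wpF n w ↔ ∃ j, ∃ l < w j, (l : ℚ) / w j = x := by
  simp [wpF]

theorem mem_wpS {n : ℕ} {w : Fin (n + 1) → ℕ} {x : ℚ} {j : Fin (n + 1)} :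
    j ∈ wpS n w x ↔ ∃ z : ℤ, (w j : ℚ) * x = z := by
  simp [wpS]

theorem card_filter_mem_wpS (n : ℕ) (w : Fin (n + 1) → ℕ) (hw : ∀ j, 0 < w j)
    (j : Fin (n + 1)) : ((wpF n w).filter fun x => j ∈ wpS n w x).card = w j := by
  have hwj : (0 : ℚ) < w j := by exact_mod_cast hw j
  have himage : ((wpF n w).filter fun x => j ∈ wpS n w x) =
      (Finset.range (w j)).image fun l : ℕ => (l : ℚ) / w j := by
    ext x
    rw [Finset.mem_filter, mem_wpF, mem_wpS, Finset.mem_image]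
    simp only [Finset.mem_range]
    constructor
    · rintro ⟨⟨i, l, hl, rfl⟩, z, hz⟩
      have hwi : (0 : ℚ) < w i := by exact_mod_cast hw i
      have hlt : (l : ℚ) / w i < 1 := by
        rw [div_lt_one hwi]; exact_mod_cast hl
      have hz0 : (0 : ℚ) ≤ z := by rw [← hz]; positivity
      have hz1 : (z : ℚ) < w j := by rw [← hz]; nlinarith
      lift z to ℕ using by exact_mod_cast hz0
      refine ⟨z, by exact_mod_cast hz1, ?_⟩
      rw [div_eq_iff hwj.ne', mul_comm]
      simpa using hz.symm
    · rintro ⟨l, hl, rfl⟩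
      exact ⟨⟨j, l, hl, rfl⟩, l, by field_simp; simp⟩
  rw [himage, Finset.card_image_of_injective, Finset.card_range]
  intro a b hab
  simpa [div_left_inj' hwj.ne'] using hab

theorem prod_prod_wpS {R : Type*} [CommMonoid R] (n : ℕ) (w : Fin (n + 1) → ℕ)
    (hw : ∀ j, 0 < w j) (g : Fin (n + 1) → R) :
    ∏ x ∈ wpF n w, ∏ j ∈ wpS n w x, g j = ∏ j, g j ^ w j := by
  rw [Finset.prod_comm' (t' := Finset.univ)
    (s' := fun j => (wpF n w).filter fun x => j ∈ wpS n w x) (by simp)]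
  exact Finset.prod_congr rfl fun j _ => by
    rw [Finset.prod_const, card_filter_mem_wpS n w hw]

theorem sum_card_wpS (n : ℕ) (w : Fin (n + 1) → ℕ) (hw : ∀ j, 0 < w j) :
    ∑ x ∈ wpF n w, (wpS n w x).card = ∑ j, w j := by
  simp_rw [Finset.card_eq_sum_ones]
  rw [Finset.sum_comm' (t' := Finset.univ)
    (s' := fun j => (wpF n w).filter fun x => j ∈ wpS n w x) (by simp)]
  exact Finset.sum_congr rfl fun j _ => by
    rw [← Finset.card_eq_sum_ones, card_filter_mem_wpS n w hw]

theorem wpS_card_pos (n : ℕ) (w : Fin (n + 1) → ℕ) (hw : ∀ j, 0 < w j) {x : ℚ}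
    (hx : x ∈ wpF n w) : 0 < (wpS n w x).card := by
  obtain ⟨j, l, -, rfl⟩ := mem_wpF.mp hx
  have hwj : (w j : ℚ) ≠ 0 := by exact_mod_cast (hw j).ne'
  exact Finset.card_pos.mpr ⟨j, mem_wpS.mpr ⟨l, by field_simp; simp⟩⟩

theorem charpoly_of_M (n k : ℕ) (w : Fin (n + 1) → ℕ) (hw : ∀ j, 0 < w j)
    (f : ℕ → ℚ)
    (hmono : ∀ i j : ℕ, 1 ≤ i → i < j → j ≤ k + 1 → f i < f j)
    (hmem : ∀ i : ℕ, 1 ≤ i → i ≤ k → f i ∈ wpF n w)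
    (hsurj : ∀ x ∈ wpF n w, ∃ i : ℕ, 1 ≤ i ∧ i ≤ k ∧ f i = x)
    (hf1 : f 1 = 0) (hfk1 : f (k + 1) = 1)
    (q : ℝ) (hq : 0 < q)
    (r : ℕ → ℝ)
    (hr_jump : ∀ α i : ℕ, 1 ≤ i → i ≤ k →
      α = ∑ l ∈ Finset.Icc 1 i, (wpS n w (f l)).card →
      r α = (1 / ∏ l ∈ wpS n w (f i), (w l : ℝ)) * q ^ ((f (i + 1) - f i : ℚ) : ℝ))
    (hr_one : ∀ α : ℕ, 1 ≤ α → α ≤ ∑ j, w j →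
      (∀ i : ℕ, 1 ≤ i → i ≤ k → α ≠ ∑ l ∈ Finset.Icc 1 i, (wpS n w (f l)).card) →
      r α = 1)
    (M : Matrix (Fin (∑ j, w j)) (Fin (∑ j, w j)) ℝ)
    (hM : ∀ β α : Fin (∑ j, w j),
      M β α = if (β : ℕ) = ((α : ℕ) + 1) % (∑ j, w j) then r ((α : ℕ) + 1) else 0) :
    M.charpoly = Polynomial.X ^ (∑ j, w j) -
      Polynomial.C (q / ∏ j, (w j : ℝ) ^ w j) := by
  have hσ : 0 < ∑ j, w j := Finset.sum_pos (fun j _ => hw j) Finset.univ_nonempty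
  rw [charpoly_weighted_cycle _ hσ r M hM]
  congr 2
  have hinj : Set.InjOn f (Finset.Icc 1 k : Finset ℕ) := by
    intro a ha b hb hab
    simp only [Finset.coe_Icc, Set.mem_Icc] at ha hb
    rcases lt_trichotomy a b with h | h | h
    · exact absurd hab (hmono a b ha.1 h (by omega)).ne
    · exact h
    · exact absurd hab (hmono b a hb.1 h (by omega)).ne'
  have himage : (Finset.Icc 1 k).image f = wpF n w := by
    ext x
    simp only [Finset.mem_image, Finset.mem_Icc]
    constructor
    · rintro ⟨i, hi, rfl⟩
      exact hmem i hi.1 hi.2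
    · intro hx
      obtain ⟨i, h1, h2, h3⟩ := hsurj x hx
      exact ⟨i, ⟨h1, h2⟩, h3⟩
  set s : ℕ → ℕ := fun i => ∑ l ∈ Finset.Icc 1 i, (wpS n w (f l)).card with hs
  have hsk : s k = ∑ j, w j := by
    rw [← sum_card_wpS n w hw, ← himage, Finset.sum_image hinj]
  have hslt : ∀ i j, i < j → j ≤ k → s i < s j := by
    intro i j hij hj
    refine Finset.sum_lt_sum_of_subset (i := j) (Finset.Icc_subset_Icc_right hij.le)
      (by simp; omega) (by simp; omega)
      (wpS_card_pos n w hw (hmem j (by omega) hj)) (fun _ _ _ => Nat.zero_le _)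
  have hsinj : Set.InjOn s (Finset.Icc 1 k : Finset ℕ) := by
    intro a ha b hb hab
    simp only [Finset.coe_Icc, Set.mem_Icc] at ha hb
    rcases lt_trichotomy a b with h | h | h
    · exact absurd hab (hslt a b h hb.2).ne
    · exact h
    · exact absurd hab (hslt b a h ha.2).ne'
  have hsub : (Finset.Icc 1 k).image s ⊆ Finset.Icc 1 (∑ j, w j) := by
    intro α hα
    simp only [Finset.mem_image, Finset.mem_Icc] at hα ⊢
    obtain ⟨i, hi, rfl⟩ := hα
    refine ⟨Nat.one_le_iff_ne_zero.mpr (Nat.ne_zero_of_lt (hslt 0 i (by omega) hi.2)), ?_⟩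
    rw [← hsk]
    rcases hi.2.lt_or_eq with h | h
    · exact (hslt i k h le_rfl).le
    · rw [h]
  have hk : 1 ≤ k := by
    by_contra h
    obtain rfl : k = 0 := by omega
    rw [zero_add, hf1] at hfk1
    exact zero_ne_one hfk1
  have htele : ∑ i ∈ Finset.Icc 1 k, (f (i + 1) - f i) = 1 := by
    rw [← Finset.Ico_add_one_right_eq_Icc, Finset.sum_Ico_sub f (by omega), hfk1, hf1, sub_zero]
  calc ∏ α ∈ Finset.Icc 1 (∑ j, w j), r α
      = ∏ α ∈ (Finset.Icc 1 k).image s, r α := by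
        refine (Finset.prod_subset hsub fun α hα hα' => ?_).symm
        rw [Finset.mem_Icc] at hα
        refine hr_one α hα.1 hα.2 fun i h1 h2 h => hα' ?_
        exact Finset.mem_image.mpr ⟨i, Finset.mem_Icc.mpr ⟨h1, h2⟩, h.symm⟩
    _ = ∏ i ∈ Finset.Icc 1 k,
          ((1 / ∏ l ∈ wpS n w (f i), (w l : ℝ)) * q ^ ((f (i + 1) - f i : ℚ) : ℝ)) := by
        rw [Finset.prod_image hsinj]
        refine Finset.prod_congr rfl fun i hi => ?_
        rw [Finset.mem_Icc] at hi
        exact hr_jump _ i hi.1 hi.2 rfl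
    _ = (1 / ∏ i ∈ Finset.Icc 1 k, ∏ l ∈ wpS n w (f i), (w l : ℝ)) *
          q ^ ((∑ i ∈ Finset.Icc 1 k, (f (i + 1) - f i) : ℚ) : ℝ) := by
        rw [Finset.prod_mul_distrib, Finset.prod_div_distrib, Finset.prod_const_one, Rat.cast_sum,
          Real.rpow_sum_of_pos hq]
    _ = q / ∏ j, (w j : ℝ) ^ w j := by
        rw [htele, ← prod_prod_wpS n w hw fun j => (w j : ℝ), ← himage, Finset.prod_image hinj,
          Rat.cast_one, Real.rpow_one, one_div_mul_eq_div]
end
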